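/- arXiv:2111.09606 — 4 statements merged into one kernel-verified Lean document; each statement's English description precedes it below -/
import Mathlib

section
/- Let p ≥ 2, d ≥ 1, and n_1, …, n_p ≥ 1. Given vectors e_k, f_k ∈ ℝ^{n_k} for k = 1, …, p and g_{k,i}, h_{k,i} ∈ ℝ^{n_k} for k = 1, …, p and i = 1, …, d, define the order-p tensor T = Σ_{k=1}^p (e_1 ⊗ ⋯ ⊗ f_k ⊗ ⋯ ⊗ e_p) + Σ_{k_1=1}^{p-1} Σ_{k_2=k_1+1}^{p} Σ_{i=1}^{d} (e_1 ⊗ ⋯ ⊗ g_{k_1,i} ⊗ ⋯ ⊗ h_{k_2,i} ⊗ ⋯ ⊗ e_p), where in each summand the displayed vector occupies the indicated factor position and all other factors are the vectors e_j. Then T admits a tensor train representation with all interior ranks equal to d+2, whose cores are: T^{(1)} ∈ ℝ^{1×n_1×(d+2)} with T^{(1)}_{1,:,1} = e_1, T^{(1)}_{1,:,2} = f_1, T^{(1)}_{1,:,2+i} = g_{1,i}; for k = 2, …, p−1, T^{(k)} ∈ ℝ^{(d+2)×n_k×(d+2)} with T^{(k)}_{1,:,1} = e_k, T^{(k)}_{1,:,2}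 = f_k, T^{(k)}_{1,:,2+i} = g_{k,i}, T^{(k)}_{2,:,2} = e_k, T^{(k)}_{2+i,:,2} = h_{k,i}, T^{(k)}_{2+i,:,2+i} = e_k, and all other entries zero; and T^{(p)} ∈ ℝ^{(d+2)×n_p×1} with T^{(p)}_{1,:,1} = f_p, T^{(p)}_{2,:,1} = e_p, T^{(p)}_{2+i,:,1} = h_{p,i}. That is, T_{u_1,…,u_p} = Σ_{s_1,…,s_{p-1}=1}^{d+2} ∏_{k=1}^p T^{(k)}_{s_{k-1},u_k,s_k} with s_0 = s_p = 1. -/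
open Finset

/-- Entries of the order-`p` tensor `T` given as the structured sum of rank-one
tensors: `T = Σ_k e₁ ⊗ ⋯ ⊗ f_k ⊗ ⋯ ⊗ e_p + Σ_{k₁<k₂} Σ_i e₁ ⊗ ⋯ ⊗ g_{k₁,i} ⊗ ⋯ ⊗ h_{k₂,i} ⊗ ⋯ ⊗ e_p`.
Indices are zero-based. -/
def structTensor (p d : ℕ) (n : Fin p → ℕ)
    (e f : (k : Fin p) → Fin (n k) → ℝ)
    (g h : (k : Fin p) → Fin d → Fin (n k) → ℝ)
    (u : (k : Fin p) → Fin (n k)) : ℝ :=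
  (∑ k : Fin p, ∏ j : Fin p, if j = k then f j (u j) else e j (u j)) +
    ∑ k₁ : Fin p, ∑ k₂ : Fin p, ∑ i : Fin d,
      if k₁ < k₂ then
        ∏ j : Fin p,
          if j = k₁ then g j i (u j)
          else if j = k₂ then h j i (u j)
          else e j (u j)
      else 0

/-- The TT core of the representation from Proposition 1 (zero-based indices):
row `0` is `(e_k, f_k, g_{k,1}, …, g_{k,d})`, column `1` is
`(f_k, e_k, h_{k,1}, …, h_{k,d})`, the diagonal entries `(2+i, 2+i)` are `e_k`,
and all other entries vanish.  The first core of the tensor train is row `0`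
of this core, and the last core is column `1`. -/
def ttCore (p d : ℕ) (n : Fin p → ℕ)
    (e f : (k : Fin p) → Fin (n k) → ℝ)
    (g h : (k : Fin p) → Fin d → Fin (n k) → ℝ)
    (k : Fin p) (s : Fin (d + 2)) (u : Fin (n k)) (t : Fin (d + 2)) : ℝ :=
  if s.val = 0 then
    if t.val = 0 then e k u
    else if t.val = 1 then f k u
    else if ht : t.val - 2 < d then g k ⟨t.val - 2, ht⟩ u else 0
  else if s.val = 1 then
    if t.val = 1 then e k u else 0
  else
    if t.val = 1 then (if hs : s.val - 2 < d then h k ⟨s.val - 2, hs⟩ u else 0)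
    else if t = s then e k u else 0

/-- The left rank index of core `k`: the boundary index `s₀ = 0` (i.e. the
first core is row `0`) for `k = 0`, and the interior index `s_{k-1}` otherwise. -/
def ttLeft (p d : ℕ) (s : Fin (p - 1) → Fin (d + 2)) (k : Fin p) : Fin (d + 2) :=
  if hk : k.val = 0 then ⟨0, by omega⟩
  else s ⟨k.val - 1, by have := k.isLt; omega⟩

/-- The right rank index of core `k`: the interior index `s_k` for `k < p - 1`,
and the boundary index `1` (i.e. the last core is column `1`) for `k = p - 1`. -/
def ttRight (p d : ℕ) (s : Fin (p - 1) → Fin (d + 2)) (k : Fin p) : Fin (d + 2) :=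
  if hk : k.val < p - 1 then s ⟨k.val, hk⟩ else ⟨1, by omega⟩

/-- Path sum of a chain of cores with boundary indices `a` and `b`. -/
def pathSum {X : Type} [Fintype X] (q : ℕ) (M : Fin (q + 1) → X → X → ℝ) (a b : X) : ℝ :=
  ∑ s : Fin q → X, ∏ k : Fin (q + 1),
    M k (Fin.cons (α := fun _ => X) a s k) (Fin.snoc (α := fun _ => X) s b k)

lemma pathSum_zero {X : Type} [Fintype X] (M : Fin 1 → X → X → ℝ) (a b : X) :
    pathSum 0 M a b = M 0 a b := by
  simp [pathSum, Fin.snoc]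

lemma pathSum_succ {X : Type} [Fintype X] (q : ℕ) (M : Fin (q + 2) → X → X → ℝ) (a b : X) :
    pathSum (q + 1) M a b = ∑ x, M 0 a x * pathSum q (fun k => M k.succ) x b := by
  unfold pathSum
  rw [← (Fin.consEquiv (fun _ : Fin (q + 1) => X)).sum_comp, Fintype.sum_prod_type]
  refine Finset.sum_congr rfl fun x _ => ?_
  rw [Finset.mul_sum]
  refine Finset.sum_congr rfl fun s _ => ?_
  rw [Fin.prod_univ_succ]
  have hs : (Fin.snoc (α := fun _ => X) ((Fin.consEquiv (fun _ : Fin (q + 1) => X)) (x, s)) b :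
      Fin (q + 2) → X) = Fin.cons (α := fun _ => X) x (Fin.snoc (α := fun _ => X) s b) :=
    (Fin.cons_snoc_eq_snoc_cons (β := X) x s b).symm
  rw [hs]
  simp only [Fin.consEquiv_apply, Fin.cons_zero, Fin.cons_succ]

/-- Scalar version of the core. -/
def coreS {d : ℕ} (E F : ℝ) (G H : Fin d → ℝ) (s t : Fin (d + 2)) : ℝ :=
  if s.val = 0 then
    if t.val = 0 then E
    else if t.val = 1 then F
    else if ht : t.val - 2 < d then G ⟨t.val - 2, ht⟩ else 0
  else if s.val = 1 then
    if t.val = 1 then E else 0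
  else
    if t.val = 1 then (if hs : s.val - 2 < d then H ⟨s.val - 2, hs⟩ else 0)
    else if t = s then E else 0

section
variable {d : ℕ} (E F : ℝ) (G H : Fin d → ℝ) (i j : Fin d)
lemma coreS00 : coreS E F G H 0 0 = E := by simp [coreS]
lemma coreS01 : coreS E F G H 0 1 = F := by simp [coreS]
lemma coreS0i : coreS E F G H 0 i.succ.succ = G i := by simp [coreS]
lemma coreS10 : coreS E F G H 1 0 = 0 := by simp [coreS]
lemma coreS11 : coreS E F G H 1 1 = E := by simp [coreS]
lemma coreS1i : coreS E F G H 1 i.succ.succ = 0 := by simp [coreS]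
lemma coreSi0 : coreS E F G H i.succ.succ 0 = 0 := by
  simp [coreS, Fin.ext_iff]
lemma coreSi1 : coreS E F G H i.succ.succ 1 = H i := by simp [coreS]
lemma coreSij : coreS E F G H i.succ.succ j.succ.succ = if j = i then E else 0 := by
  simp [coreS]
end

lemma path1 {d : ℕ} (q : ℕ) (E F : Fin (q + 1) → ℝ) (G H : Fin (q + 1) → Fin d → ℝ) :
    pathSum q (fun k => coreS (E k) (F k) (G k) (H k)) 1 1 = ∏ k, E k := by
  induction q with
  | zero => simp [pathSum_zero, coreS11]
  | succ q ih =>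
    rw [pathSum_succ, Fin.sum_univ_succ, Fin.sum_univ_succ, Fin.prod_univ_succ]
    simp only [Fin.succ_zero_eq_one, coreS10, coreS11, coreS1i]
    rw [ih (fun k => E k.succ) (fun k => F k.succ) (fun k => G k.succ) (fun k => H k.succ)]
    simp

lemma pathi {d : ℕ} (q : ℕ) (E F : Fin (q + 1) → ℝ) (G H : Fin (q + 1) → Fin d → ℝ)
    (i : Fin d) :
    pathSum q (fun k => coreS (E k) (F k) (G k) (H k)) i.succ.succ 1
      = ∑ k, ∏ j, if j = k then H j i else E j := by
  induction q with
  | zero => simp [pathSum_zero, coreSi1]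
  | succ q ih =>
    rw [pathSum_succ, Fin.sum_univ_succ, Fin.sum_univ_succ, Fin.sum_univ_succ]
    simp only [Fin.succ_zero_eq_one, coreSi0, coreSi1, coreSij]
    rw [path1 q (fun k => E k.succ) (fun k => F k.succ) (fun k => G k.succ) (fun k => H k.succ)]
    simp only [ite_mul, zero_mul, Finset.sum_ite_eq', Finset.sum_ite_eq, Finset.mem_univ, if_true]
    rw [ih (fun k => E k.succ) (fun k => F k.succ) (fun k => G k.succ) (fun k => H k.succ)]
    simp [Fin.prod_univ_succ, Finset.mul_sum, Fin.succ_ne_zero, (Fin.succ_ne_zero _).symm]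

lemma path0 {d : ℕ} (q : ℕ) (E F : Fin (q + 1) → ℝ) (G H : Fin (q + 1) → Fin d → ℝ) :
    pathSum q (fun k => coreS (E k) (F k) (G k) (H k)) 0 1
      = (∑ k, ∏ j, if j = k then F j else E j) +
        ∑ k₁ : Fin (q + 1), ∑ k₂ : Fin (q + 1), ∑ i : Fin d,
          if k₁ < k₂ then ∏ j, if j = k₁ then G j i else if j = k₂ then H j i else E j
          else 0 := by
  induction q with
  | zero => simp [pathSum_zero, coreS01]
  | succ q ih =>
    rw [pathSum_succ, Fin.sum_univ_succ, Fin.sum_univ_succ]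
    simp only [Fin.succ_zero_eq_one, coreS00, coreS01, coreS0i]
    rw [path1 q (fun k => E k.succ) (fun k => F k.succ) (fun k => G k.succ) (fun k => H k.succ),
      ih (fun k => E k.succ) (fun k => F k.succ) (fun k => G k.succ) (fun k => H k.succ)]
    have hi : ∀ i, pathSum q (fun k => coreS (E k.succ) (F k.succ) (G k.succ) (H k.succ))
        (Fin.succ (Fin.succ i)) 1 = _ := fun i => pathi q (fun k => E k.succ) (fun k => F k.succ)
          (fun k => G k.succ) (fun k => H k.succ) i
    simp only [hi]
    have h1 : (∑ k : Fin (q + 2), ∏ j, if j = k then F j else E j)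
        = F 0 * ∏ k : Fin (q + 1), E k.succ +
          E 0 * ∑ k : Fin (q + 1), ∏ j : Fin (q + 1), if j = k then F j.succ else E j.succ := by
      rw [Fin.sum_univ_succ]
      simp [Fin.prod_univ_succ, Finset.mul_sum, Fin.succ_ne_zero, (Fin.succ_ne_zero _).symm]
    have h2 : (∑ k₁ : Fin (q + 2), ∑ k₂ : Fin (q + 2), ∑ i : Fin d,
          if k₁ < k₂ then ∏ j, if j = k₁ then G j i else if j = k₂ then H j i else E j else 0)
        = (∑ i : Fin d, G 0 i * ∑ k : Fin (q + 1), ∏ j : Fin (q + 1),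
            if j = k then H j.succ i else E j.succ) +
          E 0 * ∑ k₁ : Fin (q + 1), ∑ k₂ : Fin (q + 1), ∑ i : Fin d,
          if k₁ < k₂ then ∏ j : Fin (q + 1), if j = k₁ then G j.succ i
            else if j = k₂ then H j.succ i else E j.succ
          else 0 := by
      rw [Fin.sum_univ_succ]
      congr 1
      · rw [Fin.sum_univ_succ]
        simp only [lt_self_iff_false, if_false, Finset.sum_const_zero, zero_add, Fin.succ_pos,
          if_true]
        rw [Finset.sum_comm]
        simp [Fin.prod_univ_succ, Finset.mul_sum, Fin.succ_ne_zero, (Fin.succ_ne_zero _).symm]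
      · rw [Finset.mul_sum]
        refine Finset.sum_congr rfl fun k₁ _ => ?_
        rw [Fin.sum_univ_succ, Finset.mul_sum]
        simp [Fin.prod_univ_succ, Finset.mul_sum, Fin.succ_ne_zero, (Fin.succ_ne_zero _).symm]
    rw [h1, h2]
    ring

/-- **Proposition 1**: the structured sum of rank-one tensors admits a tensor
train representation with all interior ranks equal to `d + 2` with the cores
given by `ttCore` (first core = row `0`, last core = column `1`). -/
theorem tt_representation_of_struct_tensor (p d : ℕ) (hp : 2 ≤ p) (hd : 1 ≤ d)
    (n : Fin p → ℕ) (hn : ∀ k, 1 ≤ n k)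
    (e f : (k : Fin p) → Fin (n k) → ℝ)
    (g h : (k : Fin p) → Fin d → Fin (n k) → ℝ)
    (u : (k : Fin p) → Fin (n k)) :
    structTensor p d n e f g h u =
      ∑ s : Fin (p - 1) → Fin (d + 2),
        ∏ k : Fin p,
          ttCore p d n e f g h k (ttLeft p d s k) (u k) (ttRight p d s k) := by
  obtain ⟨q, rfl⟩ : ∃ q, p = q + 1 := ⟨p - 1, by omega⟩
  have key := path0 q (fun k => e k (u k)) (fun k => f k (u k)) (fun k i => g k i (u k))
    (fun k i => h k i (u k))
  unfold structTensor
  refine key.symm.trans ?_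
  unfold pathSum
  refine Finset.sum_congr rfl fun s _ => Finset.prod_congr rfl fun k _ => ?_
  have hl : ttLeft (q + 1) d s k = Fin.cons (α := fun _ => Fin (d + 2)) 0 s k := by
    refine Fin.cases ?_ (fun k => ?_) k
    · simp [ttLeft]
    · simp [ttLeft]
  have hr : ttRight (q + 1) d s k = Fin.snoc (α := fun _ => Fin (d + 2)) s 1 k := by
    refine Fin.lastCases ?_ (fun k => ?_) k
    · simp [ttRight]
    · simp [ttRight]
  rw [hl, hr]
  rfl
end

section
/- Let p ≥ 3, d ≥ 1, n_1, …, n_p ≥ 1, and let e_k, f_k, g_{k,i}, h_{k,i} ∈ ℝ^{n_k} be given for k = 1, …, p and i = 1, …, d. Define A^{(k)} and B^{(k)}_i as follows: A^{(k)} = Σ_{l=k}^p (e_k ⊗ ⋯ ⊗ f_l ⊗ ⋯ ⊗ e_p) + Σ_{l_1=k}^{p-1} Σ_{l_2=l_1+1}^{p} Σ_{i=1}^{d} (e_k ⊗ ⋯ ⊗ g_{l_1,i} ⊗ ⋯ ⊗ h_{l_2,i} ⊗ ⋯ ⊗ e_p) and B^{(k)}_i = Σ_{l=k}^p (e_k ⊗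 ⋯ ⊗ h_{l,i} ⊗ ⋯ ⊗ e_p). For k = 2, …, p−1 let T^{(k)} ∈ ℝ^{(d+2)×n_k×(d+2)} be the core with T^{(k)}_{1,:,1} = e_k, T^{(k)}_{1,:,2} = f_k, T^{(k)}_{1,:,2+i} = g_{k,i}, T^{(k)}_{2,:,2} = e_k, T^{(k)}_{2+i,:,2} = h_{k,i}, T^{(k)}_{2+i,:,2+i} = e_k, and all other entries zero. Define the (d+2)-vector of order-(p−k) tensors W^{(k+1)} = (A^{(k+1)}, e_{k+1} ⊗ ⋯ ⊗ e_p, B^{(k+1)}_1, …, B^{(k+1)}_d) and similarly W^{(k)} = (A^{(k)}, e_k ⊗ ⋯ ⊗ e_p, B^{(k)}_1, …, B^{(k)}_d). Then for every row index s ∈ {1, …, d+2}: Σ_{t=1}^{d+2} T^{(k)}_{s,:,t} ⊗ W^{(k+1)}_t = W^{(k)}_s. -/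
open Finset

/-- Entries of the auxiliary tensor `A^{(k)}`, viewed as a function of a full
index tuple `u` (it only depends on the coordinates `u_j` with `j ≥ k`). -/
def tensorA (p d : ℕ) (n : Fin p → ℕ)
    (e f : (k : Fin p) → Fin (n k) → ℝ)
    (g h : (k : Fin p) → Fin d → Fin (n k) → ℝ)
    (k : Fin p) (u : (j : Fin p) → Fin (n j)) : ℝ :=
  (∑ l ∈ univ.filter (fun l => k ≤ l),
      ∏ j ∈ univ.filter (fun j => k ≤ j),
        if j = l then f j (u j) else e j (u j)) +
    ∑ l₁ ∈ univ.filter (fun l₁ => k ≤ l₁),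
      ∑ l₂ ∈ univ.filter (fun l₂ => l₁ < l₂),
        ∑ i : Fin d,
          ∏ j ∈ univ.filter (fun j => k ≤ j),
            if j = l₁ then g j i (u j)
            else if j = l₂ then h j i (u j)
            else e j (u j)

/-- Entries of the auxiliary tensor `B^{(k)}_i`, viewed as a function of a full
index tuple `u`. -/
def tensorB (p d : ℕ) (n : Fin p → ℕ)
    (e : (k : Fin p) → Fin (n k) → ℝ)
    (h : (k : Fin p) → Fin d → Fin (n k) → ℝ)
    (k : Fin p) (i : Fin d) (u : (j : Fin p) → Fin (n j)) : ℝ :=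
  ∑ l ∈ univ.filter (fun l => k ≤ l),
    ∏ j ∈ univ.filter (fun j => k ≤ j),
      if j = l then h j i (u j) else e j (u j)

/-- The `(d+2)`-vector of tensors
`W^{(k)} = (A^{(k)}, e_k ⊗ ⋯ ⊗ e_p, B^{(k)}_1, …, B^{(k)}_d)`,
viewed entrywise as a function of a full index tuple `u`. -/
def tensorW (p d : ℕ) (n : Fin p → ℕ)
    (e f : (k : Fin p) → Fin (n k) → ℝ)
    (g h : (k : Fin p) → Fin d → Fin (n k) → ℝ)
    (k : Fin p) (s : Fin (d + 2)) (u : (j : Fin p) → Fin (n j)) : ℝ :=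
  if s.val = 0 then tensorA p d n e f g h k u
  else if s.val = 1 then ∏ j ∈ univ.filter (fun j => k ≤ j), e j (u j)
  else if hs : s.val - 2 < d then tensorB p d n e h k ⟨s.val - 2, hs⟩ u else 0

theorem filter_le_eq_insert_aux (p : ℕ) (k k' : Fin p) (hk : k'.val = k.val + 1) :
    univ.filter (fun j => k ≤ j) = insert k (univ.filter (fun j => k' ≤ j)) := by
  ext j
  simp only [mem_filter, mem_univ, true_and, mem_insert, Fin.le_def, Fin.ext_iff]
  omega

theorem filter_lt_eq_aux (p : ℕ) (k k' : Fin p) (hk : k'.val = k.val + 1) :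
    univ.filter (fun j => k < j) = univ.filter (fun j => k' ≤ j) := by
  ext j
  simp only [mem_filter, mem_univ, true_and, Fin.le_def, Fin.lt_def]
  omega

theorem not_mem_aux (p : ℕ) (k k' : Fin p) (hk : k'.val = k.val + 1) :
    k ∉ univ.filter (fun j => k' ≤ j) := by
  simp only [mem_filter, mem_univ, true_and, Fin.le_def]
  omega

/-- Recursion for sums with a single marked factor. -/
theorem single_rec_aux {ι : Type*} [DecidableEq ι] (S : Finset ι) (k : ι) (hk : k ∉ S)
    (a b : ι → ℝ) :
    (∑ l ∈ insert k S, ∏ j ∈ insert k S, if j = l then a j else b j) =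
      a k * ∏ j ∈ S, b j + b k * ∑ l ∈ S, ∏ j ∈ S, if j = l then a j else b j := by
  rw [sum_insert hk, prod_insert hk, if_pos rfl, mul_sum]
  congr 1
  · congr 1
    refine prod_congr rfl fun j hj => ?_
    rw [if_neg (fun hh : j = k => hk (hh ▸ hj))]
  · refine sum_congr rfl fun l hl => ?_
    rw [prod_insert hk, if_neg (fun hh : k = l => hk (hh ▸ hl))]

theorem tensorB_rec_aux (p d : ℕ) (n : Fin p → ℕ)
    (e : (k : Fin p) → Fin (n k) → ℝ)
    (h : (k : Fin p) → Fin d → Fin (n k) → ℝ)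
    (k k' : Fin p) (hk : k'.val = k.val + 1) (i : Fin d) (u : (j : Fin p) → Fin (n j)) :
    tensorB p d n e h k i u =
      h k i (u k) * ∏ j ∈ univ.filter (fun j => k' ≤ j), e j (u j) +
        e k (u k) * tensorB p d n e h k' i u := by
  unfold tensorB
  rw [filter_le_eq_insert_aux p k k' hk]
  exact single_rec_aux _ k (not_mem_aux p k k' hk) (fun j => h j i (u j)) (fun j => e j (u j))

theorem tensorA_rec_aux (p d : ℕ) (n : Fin p → ℕ)
    (e f : (k : Fin p) → Fin (n k) → ℝ)
    (g h : (k : Fin p) → Fin d → Fin (n k) → ℝ)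
    (k k' : Fin p) (hk : k'.val = k.val + 1) (u : (j : Fin p) → Fin (n j)) :
    tensorA p d n e f g h k u =
      e k (u k) * tensorA p d n e f g h k' u +
      (f k (u k) * ∏ j ∈ univ.filter (fun j => k' ≤ j), e j (u j) +
        ∑ i : Fin d, g k i (u k) * tensorB p d n e h k' i u) := by
  have hn := not_mem_aux p k k' hk
  unfold tensorA tensorB
  rw [filter_le_eq_insert_aux p k k' hk,
    single_rec_aux _ k hn (fun j => f j (u j)) (fun j => e j (u j)),
    sum_insert hn, filter_lt_eq_aux p k k' hk]
  have h1 : (∑ l₂ ∈ univ.filter (fun j => k' ≤ j), ∑ i : Fin d,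
      ∏ j ∈ insert k (univ.filter (fun j => k' ≤ j)),
        if j = k then g j i (u j) else if j = l₂ then h j i (u j) else e j (u j)) =
      ∑ i : Fin d, g k i (u k) * ∑ l ∈ univ.filter (fun j => k' ≤ j),
        ∏ j ∈ univ.filter (fun j => k' ≤ j), if j = l then h j i (u j) else e j (u j) := by
    rw [sum_comm]
    refine sum_congr rfl fun i _ => ?_
    rw [mul_sum]
    refine sum_congr rfl fun l _ => ?_
    rw [prod_insert hn, if_pos rfl]
    congr 1
    refine prod_congr rfl fun j hj => ?_
    rw [if_neg (fun hh : j = k => hn (hh ▸ hj))]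
  have h2 : (∑ l₁ ∈ univ.filter (fun j => k' ≤ j), ∑ l₂ ∈ univ.filter (fun l₂ => l₁ < l₂),
      ∑ i : Fin d, ∏ j ∈ insert k (univ.filter (fun j => k' ≤ j)),
        if j = l₁ then g j i (u j) else if j = l₂ then h j i (u j) else e j (u j)) =
      e k (u k) * ∑ l₁ ∈ univ.filter (fun j => k' ≤ j), ∑ l₂ ∈ univ.filter (fun l₂ => l₁ < l₂),
      ∑ i : Fin d, ∏ j ∈ univ.filter (fun j => k' ≤ j),
        if j = l₁ then g j i (u j) else if j = l₂ then h j i (u j) else e j (u j) := by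
    simp only [mul_sum]
    refine sum_congr rfl fun l₁ hl₁ => sum_congr rfl fun l₂ hl₂ => sum_congr rfl fun i _ => ?_
    have a1 : k ≠ l₁ := fun hh => hn (hh ▸ hl₁)
    have a2 : k ≠ l₂ := by
      rintro rfl
      simp only [mem_filter, mem_univ, true_and, Fin.le_def, Fin.lt_def] at hl₁ hl₂
      omega
    rw [prod_insert hn, if_neg a1, if_neg a2]
  rw [h1, h2]
  ring

/-- **Core recursion** (Eq. (14) in the paper): for `k = 2, …, p-1` (zero-based:
`1 ≤ k` and `k + 1 ≤ p - 1`) and every row index `s`,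
`Σ_t T^{(k)}_{s,:,t} ⊗ W^{(k+1)}_t = W^{(k)}_s`, stated entrywise. -/
theorem core_times_W_recursion (p d : ℕ) (hp : 3 ≤ p) (hd : 1 ≤ d)
    (n : Fin p → ℕ) (hn : ∀ k, 1 ≤ n k)
    (e f : (k : Fin p) → Fin (n k) → ℝ)
    (g h : (k : Fin p) → Fin d → Fin (n k) → ℝ)
    (k : Fin p) (hk1 : 1 ≤ k.val) (hk2 : k.val + 1 ≤ p - 1)
    (u : (j : Fin p) → Fin (n j)) (s : Fin (d + 2)) :
    (∑ t : Fin (d + 2),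
        ttCore p d n e f g h k s (u k) t *
          tensorW p d n e f g h ⟨k.val + 1, by omega⟩ t u) =
      tensorW p d n e f g h k s u := by
  have hkk : (⟨k.val + 1, by omega⟩ : Fin p).val = k.val + 1 := rfl
  generalize (⟨k.val + 1, by omega⟩ : Fin p) = k' at hkk ⊢
  have hn := not_mem_aux p k k' hkk
  rw [Fin.sum_univ_succ, Fin.sum_univ_succ]
  refine Fin.cases ?_ (fun s => Fin.cases ?_ (fun i => ?_) s) s
  · simp [ttCore, tensorW, tensorA_rec_aux p d n e f g h k k' hkk]
  · simp [ttCore, tensorW, filter_le_eq_insert_aux p k k' hkk, prod_insert hn]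
  · simp [ttCore, tensorW, tensorB_rec_aux p d n e h k k' hkk]
    intro h0
    exact absurd h0.symm (Fin.succ_ne_zero _)
end

section
/- Let p ≥ 3, d ≥ 1, n_1, …, n_p ≥ 1, and for k = 1, …, p let ψ_k : ℝ^d → ℝ^{n_k} be differentiable at x ∈ ℝ^d, with ∂ψ_k/∂x^i(x) ∈ ℝ^{n_k} the vector of partial derivatives with respect to the i-th coordinate. Define the order-(p+1) tensor ∇Ψ(x) ∈ ℝ^{n_1×⋯×n_p×d} by ∇Ψ(x)_{u_1,…,u_p,i} = ∂/∂x^i (ψ_{1,u_1} ⋯ ψ_{p,u_p})(x). Then ∇Ψ(x) admits a tensor train representation with ranks r_1 = ⋯ = r_{p-1} = d+1 and r_p = d, with cores: core 1 ∈ ℝ^{1×n_1×(d+1)} with entries (1,:,1) = ψ_1(x) and (1,:,1+i) = ∂ψ_1/∂x^i(x) for i = 1, …, d; for k = 2, …, p−1, core k ∈ ℝ^{(d+1)×n_k×(d+1)} with entries (1,:,1) = ψ_k(x), (1,:,1+i) = ∂ψ_k/∂x^i(x), (1+i,:,1+i) = ψ_k(x), and all other entries zero; core p ∈ ℝ^{(d+1)×n_p×d}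 with entries (1,:,i) = ∂ψ_p/∂x^i(x), (1+i,:,i) = ψ_p(x), and all other entries zero; and core p+1 ∈ ℝ^{d×d×1} with entries (i,:,1) = e_i, the i-th canonical unit vector of ℝ^d. That is, ∇Ψ(x)_{u_1,…,u_p,j} equals the sum over all interior rank indices of the product of the corresponding core entries. -/
open Finset

/-- The partial derivative `∂φ/∂x^i (x)` of a scalar function on `ℝ^d`. -/
noncomputable def partialD (d : ℕ) (φ : (Fin d → ℝ) → ℝ) (x : Fin d → ℝ)
    (i : Fin d) : ℝ :=
  fderiv ℝ φ x (Pi.single i 1)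

/-- The TT core of rank `d + 1` from Corollary 2 (zero-based indices):
row `0` is `(ψ_k(x), ∂ψ_k/∂x^1(x), …, ∂ψ_k/∂x^d(x))`, the diagonal entries
`(1+i, 1+i)` are `ψ_k(x)`, and all other entries vanish.  The first core of the
tensor train is row `0` of this core; core `p` (of size `(d+1) × n_p × d`) is
obtained by deleting column `0`, i.e. its column `i : Fin d` is the column
`1 + i` of this core. -/
noncomputable def gradCore (p d : ℕ) (n : Fin p → ℕ)
    (ψ : (k : Fin p) → (Fin d → ℝ) → Fin (n k) → ℝ) (x : Fin d → ℝ)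
    (k : Fin p) (s : Fin (d + 1)) (u : Fin (n k)) (t : Fin (d + 1)) : ℝ :=
  if s.val = 0 then
    if t.val = 0 then ψ k x u
    else if ht : t.val - 1 < d then partialD d (fun y => ψ k y u) x ⟨t.val - 1, ht⟩
    else 0
  else if t = s then ψ k x u else 0

/-- The scalar version of the core attached to one function. -/
noncomputable def sCore (d : ℕ) (φ : (Fin d → ℝ) → ℝ) (x : Fin d → ℝ)
    (s t : Fin (d + 1)) : ℝ :=
  if s.val = 0 then
    if t.val = 0 then φ x
    else if ht : t.val - 1 < d then partialD d φ x ⟨t.val - 1, ht⟩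
    else 0
  else if t = s then φ x else 0

lemma sCore_zero_zero (d : ℕ) (φ : (Fin d → ℝ) → ℝ) (x : Fin d → ℝ) :
    sCore d φ x 0 0 = φ x := by simp [sCore]

lemma sCore_zero_succ (d : ℕ) (φ : (Fin d → ℝ) → ℝ) (x : Fin d → ℝ) (j : Fin d) :
    sCore d φ x 0 j.succ = partialD d φ x j := by simp [sCore]

lemma sCore_succ (d : ℕ) (φ : (Fin d → ℝ) → ℝ) (x : Fin d → ℝ) (j : Fin d)
    (t : Fin (d + 1)) :
    sCore d φ x j.succ t = if t = j.succ then φ x else 0 := by simp [sCore]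

/-- The core is multiplicative. -/
lemma sCore_mul (d : ℕ) (f g : (Fin d → ℝ) → ℝ) (x : Fin d → ℝ)
    (hf : DifferentiableAt ℝ f x) (hg : DifferentiableAt ℝ g x) (s t : Fin (d + 1)) :
    ∑ r, sCore d f x s r * sCore d g x r t = sCore d (fun y => f y * g y) x s t := by
  refine Fin.cases ?_ (fun j => ?_) s
  · rw [Fin.sum_univ_succ]
    refine Fin.cases ?_ (fun l => ?_) t
    · simp [sCore_zero_zero, sCore_succ, (Fin.succ_ne_zero _).symm]
    · simp only [sCore_zero_zero, sCore_zero_succ, sCore_succ, Fin.succ_inj, mul_ite, mul_zero,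
        Finset.sum_ite_eq, Finset.mem_univ, if_true]
      simp only [partialD]
      rw [fderiv_fun_mul hf hg]
      simp [mul_comm]
  · simp [sCore_succ]

lemma sCore_prod (d : ℕ) (x : Fin d → ℝ) (q : ℕ) (f : Fin (q + 1) → (Fin d → ℝ) → ℝ)
    (hf : ∀ k, DifferentiableAt ℝ (f k) x) (s0 t0 : Fin (d + 1)) :
    ∑ s : Fin q → Fin (d + 1), ∏ k : Fin (q + 1),
      sCore d (f k) x (Fin.cons (α := fun _ => Fin (d + 1)) s0 s k)
        (Fin.snoc (α := fun _ => Fin (d + 1)) s t0 k)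
      = sCore d (fun y => ∏ k, f k y) x s0 t0 := by
  induction q generalizing s0 with
  | zero => simp [Fin.snoc]
  | succ q ih =>
    rw [← (Fin.consEquiv (fun _ : Fin (q + 1) => Fin (d + 1))).sum_comp, Fintype.sum_prod_type]
    change ∑ r : Fin (d + 1), ∑ s : Fin q → Fin (d + 1), ∏ k : Fin (q + 1 + 1),
      sCore d (f k) x (Fin.cons (α := fun _ => Fin (d + 1)) s0
        (Fin.cons (α := fun _ => Fin (d + 1)) r s) k)
        (Fin.snoc (α := fun _ => Fin (d + 1)) (Fin.cons (α := fun _ => Fin (d + 1)) r s) t0 k) = _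
    simp_rw [Fin.prod_univ_succ (n := q + 1)]
    rw [← sCore_mul d (f 0) (fun y => ∏ k : Fin (q + 1), f k.succ y) x (hf 0)
      (by have := hf; fun_prop)]
    refine Finset.sum_congr rfl fun r _ => ?_
    rw [← ih (fun k => f k.succ) (fun k => hf _) r, Finset.mul_sum]
    refine Finset.sum_congr rfl fun s _ => ?_
    simp only [← Fin.cons_snoc_eq_snoc_cons, Fin.cons_succ, Fin.cons_zero]

/-- **Corollary 2**: the gradient tensor
`∇Ψ(x)_{u₁,…,u_p,i} = ∂/∂x^i (ψ_{1,u₁} ⋯ ψ_{p,u_p})(x)` admits a tensor train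
representation with ranks `r₁ = ⋯ = r_{p-1} = d + 1`, `r_p = d`: cores
`1, …, p` are given by `gradCore` (first core = row `0`; core `p` has right
rank `d`, its column `t : Fin d` being column `1 + t` of `gradCore`), and core
`p + 1` has entries `(t, j) ↦ (e_t)_j = δ_{tj}`. -/
theorem gradient_tensor_tt_representation (p d : ℕ) (hp : 3 ≤ p) (hd : 1 ≤ d)
    (n : Fin p → ℕ) (hn : ∀ k, 1 ≤ n k)
    (ψ : (k : Fin p) → (Fin d → ℝ) → Fin (n k) → ℝ)
    (x : Fin d → ℝ)
    (hdiff : ∀ (k : Fin p) (v : Fin (n k)), DifferentiableAt ℝ (fun y => ψ k y v) x)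
    (u : (k : Fin p) → Fin (n k)) (i : Fin d) :
    fderiv ℝ (fun y => ∏ k : Fin p, ψ k y (u k)) x (Pi.single i 1) =
      ∑ s : Fin (p - 1) → Fin (d + 1), ∑ t : Fin d,
        (∏ k : Fin p,
            gradCore p d n ψ x k
              (if hk : k.val = 0 then ⟨0, by omega⟩
               else s ⟨k.val - 1, by have := k.isLt; omega⟩)
              (u k)
              (if hk : k.val < p - 1 then s ⟨k.val, hk⟩
               else ⟨t.val + 1, by have := t.isLt; omega⟩)) *
          (if i = t then 1 else 0) := by
  obtain ⟨q, rfl⟩ : ∃ q, p = q + 1 := ⟨p - 1, by omega⟩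
  have key := sCore_prod d x q (fun k y => ψ k y (u k)) (fun k => hdiff k (u k)) 0 i.succ
  rw [sCore_zero_succ] at key
  change partialD d _ x i = _
  rw [← key]
  change _ = ∑ s : Fin q → Fin (d + 1), _
  refine Finset.sum_congr rfl fun s _ => ?_
  simp only [mul_ite, mul_one, mul_zero, Finset.sum_ite_eq, Finset.mem_univ, if_true]
  refine Finset.prod_congr rfl fun k _ => ?_
  change _ = sCore d (fun y => ψ k y (u k)) x _ _
  congr 1
  refine Fin.cases ?_ (fun l => ?_) k
  · simp
  · simp
end

section
/- Let p ≥ 1, d ≥ 1, n_1, …, n_p ≥ 1. Let b : ℝ^d → ℝ^d and σ : ℝ^d → ℝ^{d×d} be given, set a(x) = σ(x)σ(x)^T, and define the Kolmogorov backward operator L acting on twice continuously differentiable scalar functions φ by Lφ(x) = ½ Σ_{i,j=1}^d a_{ij}(x) ∂²φ/∂x^i∂x^j(x) + Σ_{i=1}^d b_i(x) ∂φ/∂x^i(x). For k = 1, …, p let ψ_k : ℝ^d → ℝ^{n_k} be twice continuously differentiable, and fix x ∈ ℝ^d. Define the order-p tensor LΨ(x) ∈ ℝ^{n_1×⋯×n_p}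 entrywise by LΨ(x)_{u_1,…,u_p} = L(ψ_{1,u_1} ⋯ ψ_{p,u_p})(x). Then LΨ(x) = Σ_{k=1}^p ψ_1(x) ⊗ ⋯ ⊗ Lψ_k(x) ⊗ ⋯ ⊗ ψ_p(x) + Σ_{s=1}^d Σ_{k_1=1}^{p-1} Σ_{k_2=k_1+1}^{p} ψ_1(x) ⊗ ⋯ ⊗ (∇ψ_{k_1}(x)·σ_{:,s}(x)) ⊗ ⋯ ⊗ (∇ψ_{k_2}(x)·σ_{:,s}(x)) ⊗ ⋯ ⊗ ψ_p(x), where Lψ_k(x) ∈ ℝ^{n_k} is the vector of values of L applied to the components of ψ_k, ∇ψ_k(x) ∈ ℝ^{n_k×d} is the Jacobian of ψ_k, σ_{:,s}(x) ∈ ℝ^d is the s-th column of σ(x), and in each summand the displayed vectors occupy the indicated factor positions while all other factors are the vectors ψ_l(x). -/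
open Finset

/-- The Kolmogorov backward operator
`Lφ(x) = ½ Σ_{i,j} a_{ij}(x) ∂²φ/∂x^i∂x^j(x) + Σ_i b_i(x) ∂φ/∂x^i(x)` with
`a(x) = σ(x)σ(x)ᵀ`, i.e. `a_{ij}(x) = Σ_s σ_{is}(x) σ_{js}(x)`; partial
derivatives are expressed via (iterated) Fréchet derivatives applied to
canonical unit vectors. -/
noncomputable def Lgen (d : ℕ) (b : (Fin d → ℝ) → Fin d → ℝ)
    (σ : (Fin d → ℝ) → Fin d → Fin d → ℝ)
    (φ : (Fin d → ℝ) → ℝ) (x : Fin d → ℝ) : ℝ :=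
  (1 / 2) * (∑ i : Fin d, ∑ j : Fin d,
      (∑ s : Fin d, σ x i s * σ x j s) *
        fderiv ℝ (fun y => fderiv ℝ φ y (Pi.single j 1)) x (Pi.single i 1)) +
    ∑ i : Fin d, b x i * fderiv ℝ φ x (Pi.single i 1)

/-- The directional derivative along the `s`-th column of `σ`. -/
noncomputable def Dcol (d : ℕ) (σ : (Fin d → ℝ) → Fin d → Fin d → ℝ) (s : Fin d)
    (φ : (Fin d → ℝ) → ℝ) (x : Fin d → ℝ) : ℝ :=
  ∑ i : Fin d, fderiv ℝ φ x (Pi.single i 1) * σ x i s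

theorem fderiv_mul_single {d : ℕ} {f g : (Fin d → ℝ) → ℝ} (hf : ContDiff ℝ 2 f)
    (hg : ContDiff ℝ 2 g) (x v : Fin d → ℝ) :
    fderiv ℝ (fun y => f y * g y) x v = fderiv ℝ f x v * g x + f x * fderiv ℝ g x v := by
  rw [fderiv_fun_mul (hf.differentiable (by norm_num) x) (hg.differentiable (by norm_num) x)]
  simp
  ring

theorem Dcol_mul {d : ℕ} (σ : (Fin d → ℝ) → Fin d → Fin d → ℝ) (s : Fin d)
    {f g : (Fin d → ℝ) → ℝ} (hf : ContDiff ℝ 2 f)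
    (hg : ContDiff ℝ 2 g) (x : Fin d → ℝ) :
    Dcol d σ s (fun y => f y * g y) x = Dcol d σ s f x * g x + f x * Dcol d σ s g x := by
  simp only [Dcol, fderiv_mul_single hf hg, Finset.sum_mul, Finset.mul_sum]
  rw [← Finset.sum_add_distrib]
  exact Finset.sum_congr rfl fun i _ => by ring

theorem differentiable_partial {d : ℕ} {f : (Fin d → ℝ) → ℝ} (hf : ContDiff ℝ 2 f)
    (v : Fin d → ℝ) : Differentiable ℝ (fun y => fderiv ℝ f y v) := by
  have h : ContDiff ℝ 1 (fderiv ℝ f) := hf.fderiv_right (by norm_num)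
  exact (h.differentiable (by norm_num)).clm_apply (differentiable_const v)

theorem fderiv_fderiv_mul {d : ℕ} {f g : (Fin d → ℝ) → ℝ} (hf : ContDiff ℝ 2 f)
    (hg : ContDiff ℝ 2 g) (x v w : Fin d → ℝ) :
    fderiv ℝ (fun y => fderiv ℝ (fun y => f y * g y) y v) x w =
      fderiv ℝ (fun y => fderiv ℝ f y v) x w * g x + f x * fderiv ℝ (fun y => fderiv ℝ g y v) x w
      + (fderiv ℝ f x v * fderiv ℝ g x w + fderiv ℝ f x w * fderiv ℝ g x v) := by
  simp only [fderiv_mul_single hf hg]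
  have f1 := hf.differentiable (by norm_num)
  have g1 := hg.differentiable (by norm_num)
  have f2 := differentiable_partial hf v
  have g2 := differentiable_partial hg v
  rw [fderiv_fun_add ((f2 x).fun_mul (g1 x)) ((f1 x).fun_mul (g2 x)), fderiv_fun_mul (f2 x) (g1 x),
    fderiv_fun_mul (f1 x) (g2 x)]
  simp
  ring

theorem cross_term {d : ℕ} (σ : Fin d → Fin d → ℝ) (F G : Fin d → ℝ) :
    (1 / 2) * (∑ i : Fin d, ∑ j : Fin d,
      (∑ s : Fin d, σ i s * σ j s) * (F j * G i + F i * G j)) =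
    ∑ s : Fin d, (∑ i, F i * σ i s) * (∑ i, G i * σ i s) := by
  have h1 : ∑ i : Fin d, ∑ j : Fin d, (∑ s : Fin d, σ i s * σ j s) * (F i * G j) =
      ∑ s : Fin d, (∑ i, F i * σ i s) * (∑ i, G i * σ i s) := by
    simp only [Finset.sum_mul]
    calc _ = ∑ i : Fin d, ∑ s : Fin d, ∑ j : Fin d, σ i s * σ j s * (F i * G j) :=
          Finset.sum_congr rfl fun i _ => Finset.sum_comm
      _ = ∑ s : Fin d, ∑ i : Fin d, ∑ j : Fin d, σ i s * σ j s * (F i * G j) := Finset.sum_comm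
      _ = _ := by
        refine Finset.sum_congr rfl fun s _ => ?_
        rw [← Finset.sum_mul, Finset.sum_mul_sum]
        exact Finset.sum_congr rfl fun i _ => Finset.sum_congr rfl fun j _ => by ring
  have h2 : ∑ i : Fin d, ∑ j : Fin d, (∑ s : Fin d, σ i s * σ j s) * (F j * G i) =
      ∑ i : Fin d, ∑ j : Fin d, (∑ s : Fin d, σ i s * σ j s) * (F i * G j) := by
    rw [Finset.sum_comm]
    simp only [mul_comm]
  simp only [mul_add, Finset.sum_add_distrib]
  rw [h2, h1]
  ring

theorem Lgen_mul {d : ℕ} (b : (Fin d → ℝ) → Fin d → ℝ)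
    (σ : (Fin d → ℝ) → Fin d → Fin d → ℝ)
    {f g : (Fin d → ℝ) → ℝ} (hf : ContDiff ℝ 2 f)
    (hg : ContDiff ℝ 2 g) (x : Fin d → ℝ) :
    Lgen d b σ (fun y => f y * g y) x = Lgen d b σ f x * g x + f x * Lgen d b σ g x +
      ∑ s, Dcol d σ s f x * Dcol d σ s g x := by
  unfold Dcol
  rw [← cross_term (σ x)]
  unfold Lgen
  have h2 := fderiv_fderiv_mul hf hg x
  have h1 := fderiv_mul_single hf hg x
  simp_rw [h2, h1]
  simp only [add_mul, mul_add, Finset.sum_add_distrib, Finset.sum_mul, Finset.mul_sum]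
  simp only [mul_assoc, mul_comm, mul_left_comm]
  ring

theorem Dcol_prod {d : ℕ} (σ : (Fin d → ℝ) → Fin d → Fin d → ℝ) (s : Fin d) (x : Fin d → ℝ) :
    ∀ (p : ℕ) (f : Fin p → (Fin d → ℝ) → ℝ) (_ : ∀ k, ContDiff ℝ 2 (f k)),
    Dcol d σ s (fun y => ∏ k, f k y) x =
      ∑ k, ∏ l, if l = k then Dcol d σ s (f l) x else f l x := by
  intro p
  induction p with
  | zero => intro f _; simp [Dcol]
  | succ p ih =>
    intro f hf
    have hg : ContDiff ℝ 2 (fun y => ∏ k : Fin p, f k.succ y) :=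
      contDiff_prod fun k _ => hf k.succ
    simp only [Fin.prod_univ_succ]
    rw [Dcol_mul σ s (hf 0) hg, ih _ fun k => hf k.succ, Fin.sum_univ_succ]
    simp [Fin.succ_ne_zero, (Fin.succ_ne_zero _).symm, Finset.mul_sum]

theorem Lgen_prod {d : ℕ} (b : (Fin d → ℝ) → Fin d → ℝ)
    (σ : (Fin d → ℝ) → Fin d → Fin d → ℝ) (x : Fin d → ℝ) :
    ∀ (p : ℕ) (f : Fin p → (Fin d → ℝ) → ℝ) (_ : ∀ k, ContDiff ℝ 2 (f k)),
    Lgen d b σ (fun y => ∏ k, f k y) x =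
      (∑ k, ∏ l, if l = k then Lgen d b σ (f l) x else f l x) +
      ∑ s : Fin d, ∑ k₁ : Fin p, ∑ k₂ : Fin p, if k₁ < k₂ then
        ∏ l : Fin p, if l = k₁ then Dcol d σ s (f l) x
          else if l = k₂ then Dcol d σ s (f l) x else f l x
        else 0 := by
  intro p
  induction p with
  | zero => intro f _; simp [Lgen]
  | succ p ih =>
    intro f hf
    have hg : ContDiff ℝ 2 (fun y => ∏ k : Fin p, f k.succ y) :=
      contDiff_prod fun k _ => hf k.succ
    simp only [Fin.prod_univ_succ]
    rw [Lgen_mul b σ (hf 0) hg, ih _ fun k => hf k.succ]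
    simp only [Dcol_prod σ _ x p _ fun k => hf k.succ]
    simp [Fin.sum_univ_succ, Fin.succ_ne_zero, (Fin.succ_ne_zero _).symm, Finset.mul_sum,
      Finset.sum_add_distrib, mul_add]
    ring

/-- **Lemma 3**: for the product tensor `Ψ(x)_{u₁,…,u_p} = ψ_{1,u₁}(x) ⋯ ψ_{p,u_p}(x)`,
`LΨ(x) = Σ_k ψ₁(x) ⊗ ⋯ ⊗ Lψ_k(x) ⊗ ⋯ ⊗ ψ_p(x)
  + Σ_s Σ_{k₁<k₂} ψ₁(x) ⊗ ⋯ ⊗ (∇ψ_{k₁}(x)·σ_{:,s}(x)) ⊗ ⋯ ⊗ (∇ψ_{k₂}(x)·σ_{:,s}(x)) ⊗ ⋯ ⊗ ψ_p(x)`,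
stated entrywise, where `(∇ψ_k(x)·σ_{:,s}(x))_v = Σ_i ∂ψ_{k,v}/∂x^i(x) σ_{is}(x)`. -/
theorem generator_product_rule (p d : ℕ) (hp : 1 ≤ p) (hd : 1 ≤ d)
    (n : Fin p → ℕ) (hn : ∀ k, 1 ≤ n k)
    (b : (Fin d → ℝ) → Fin d → ℝ)
    (σ : (Fin d → ℝ) → Fin d → Fin d → ℝ)
    (ψ : (k : Fin p) → (Fin d → ℝ) → Fin (n k) → ℝ)
    (hsmooth : ∀ (k : Fin p) (v : Fin (n k)), ContDiff ℝ 2 (fun y => ψ k y v))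
    (x : Fin d → ℝ)
    (u : (k : Fin p) → Fin (n k)) :
    Lgen d b σ (fun y => ∏ k : Fin p, ψ k y (u k)) x =
      (∑ k : Fin p, ∏ l : Fin p,
          if l = k then Lgen d b σ (fun y => ψ l y (u l)) x
          else ψ l x (u l)) +
        ∑ s : Fin d, ∑ k₁ : Fin p, ∑ k₂ : Fin p,
          if k₁ < k₂ then
            ∏ l : Fin p,
              if l = k₁ then
                ∑ i : Fin d, fderiv ℝ (fun y => ψ l y (u l)) x (Pi.single i 1) * σ x i s
              else if l = k₂ then
                ∑ i : Fin d, fderiv ℝ (fun y => ψ l y (u l)) x (Pi.single i 1) * σ x i s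
              else ψ l x (u l)
          else 0 := by
  exact Lgen_prod b σ x p (fun k y => ψ k y (u k)) fun k => hsmooth k (u k)
end
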